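/- arXiv:2006.04503 — 2 statements merged into one kernel-verified Lean document; each statement's English description precedes it below -/
import Mathlib

section
/- For each fixed positive integer β, the limit as N → ∞ of (∏_{j=1}^{N} Γ(j)Γ(j + 2β)/Γ(j + β)^2) / N^{β^2} exists and equals ∏_{j=0}^{β-1} j! / (j + β)!. In particular, ∏_{j=1}^{N} Γ(j)Γ(j + 2β)/Γ(j + β)^2 ∼ (∏_{j=0}^{β-1} j!/(j+β)!) · N^{β^2} as N → ∞. -/
open Filter

/-- The ratio `(n + k)! / n!` is a product of `k` consecutive integers. -/
lemma factorial_add_div_factorial (n k : ℕ) :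
    ((n + k).factorial : ℝ) / n.factorial = ∏ i ∈ Finset.range k, ((n : ℝ) + 1 + i) := by
  rw [← Nat.factorial_mul_ascFactorial, Nat.ascFactorial_eq_prod_range]
  push_cast
  exact mul_div_cancel_left₀ _ (by positivity)

/-- Closed form of the moments: a finite product whose number of factors depends only on `β`. -/
lemma prod_Gamma_ratio_eq (β N : ℕ) :
    ∏ j ∈ Finset.Icc 1 N, Real.Gamma j * Real.Gamma (j + 2 * β) / Real.Gamma (j + β) ^ 2 =
      ∏ j ∈ Finset.range β, ((j.factorial : ℝ) / (j + β).factorial *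
        (((N + j + β).factorial : ℝ) / (N + j).factorial)) := by
  induction N with
  | zero =>
    symm
    simp only [zero_add, Finset.Icc_eq_empty_of_lt zero_lt_one, Finset.prod_empty]
    refine Finset.prod_eq_one fun j _ => ?_
    field_simp
  | succ N ih =>
    have hGamma (m : ℕ) : Real.Gamma (((N + 1 : ℕ) : ℝ) + m) = (N + m).factorial := by
      rw [← Real.Gamma_nat_eq_factorial]
      push_cast
      ring_nf
    have hGamma_zero : Real.Gamma ((N + 1 : ℕ) : ℝ) = N.factorial := by simpa using hGamma 0
    have hGamma_two : Real.Gamma (((N + 1 : ℕ) : ℝ) + 2 * β) = (N + β + β).factorial := by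
      simpa [two_mul, add_assoc] using hGamma (2 * β)
    have hfactor : ∀ j ∈ Finset.range β,
        (j.factorial : ℝ) / (j + β).factorial *
            (((N + 1 + j + β).factorial : ℝ) / (N + 1 + j).factorial) =
          (j.factorial : ℝ) / (j + β).factorial *
            (((N + j + β).factorial : ℝ) / (N + j).factorial) *
            ((((N + β : ℕ) : ℝ) + 1 + j) / ((N : ℝ) + 1 + j)) := by
      intro j _
      rw [show N + 1 + j + β = N + j + β + 1 by ring, show N + 1 + j = N + j + 1 by ring,
        Nat.factorial_succ, Nat.factorial_succ]
      push_cast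
      field_simp
      ring
    rw [Finset.prod_Icc_succ_top (by omega), ih, Finset.prod_congr rfl hfactor,
      Finset.prod_mul_distrib (g := fun j : ℕ => (((N + β : ℕ) : ℝ) + 1 + j) / ((N : ℝ) + 1 + j)),
      Finset.prod_div_distrib, ← factorial_add_div_factorial, ← factorial_add_div_factorial,
      hGamma_zero, hGamma_two, hGamma]
    congr 1
    field_simp

/-- `(N + j + k)! / (N + j)!` is asymptotic to `N ^ k`. -/
lemma tendsto_factorial_ratio_div_pow (j k : ℕ) :
    Tendsto (fun N : ℕ => ((N + j + k).factorial : ℝ) / (N + j).factorial / (N : ℝ) ^ k)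
      atTop (nhds 1) := by
  have hfactor (i : ℕ) :
      Tendsto (fun N : ℕ => (((N + j : ℕ) : ℝ) + 1 + i) / (N : ℝ)) atTop (nhds 1) := by
    have hlim := (tendsto_const_div_atTop_nhds_zero_nat ((j : ℝ) + 1 + i)).const_add 1
    rw [add_zero] at hlim
    refine hlim.congr' ?_
    filter_upwards [eventually_gt_atTop 0] with N hN
    push_cast
    field_simp
    ring
  have hprod := tendsto_finsetProd (Finset.range k) fun i _ => hfactor i
  simp only [Finset.prod_const_one] at hprod
  refine hprod.congr fun N => ?_
  rw [factorial_add_div_factorial, Finset.prod_div_distrib, Finset.prod_const, Finset.card_range]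

/-- For fixed `β ∈ ℕ`, `∏_{j=1}^{N} Γ(j)Γ(j+2β)/Γ(j+β)² ∼ (∏_{j=0}^{β-1} j!/(j+β)!) · N^{β²}`
as `N → ∞`: the ratio of the product to `N^{β²}` tends to `∏_{j=0}^{β-1} j!/(j+β)!`. -/
theorem keating_snaith_asymptotic (β : ℕ) (hβ : 0 < β) :
    Tendsto
      (fun N : ℕ =>
        (∏ j ∈ Finset.Icc 1 N,
            Real.Gamma j * Real.Gamma (j + 2 * β) / Real.Gamma (j + β) ^ 2)
          / (N : ℝ) ^ (β ^ 2))
      atTop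
      (nhds (∏ j ∈ Finset.range β, (Nat.factorial j : ℝ) / Nat.factorial (j + β))) := by
  have hlim := tendsto_finsetProd (Finset.range β) fun j _ =>
    (tendsto_factorial_ratio_div_pow j β).const_mul
      ((Nat.factorial j : ℝ) / Nat.factorial (j + β))
  simp only [mul_one] at hlim
  refine hlim.congr fun N => ?_
  rw [prod_Gamma_ratio_eq, sq, pow_mul]
  simp only [← mul_div_assoc, Finset.prod_div_distrib, Finset.prod_const, Finset.card_range]
end

section
/- For every integer n ≥ 1, the family indexed by prime numbers p of positive real numbers (1 - 1/p)^{(n-1)^2} · Σ_{m=0}^{n-1} binom(n-1, m)^2 p^{-m} is multipliable, and its product α_n = ∏_p (1 - 1/p)^{(n-1)^2} Σ_{m=0}^{n-1} binom(n-1, m)^2 p^{-m} over all primes converges to a strictly positive real number. -/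
open Polynomial in
/-- A real polynomial of the form `1 + O(X²)` differs from `1` by at most `C x²` on `[0, 1]`. -/
lemma Polynomial.exists_abs_eval_sub_one_le_mul_sq {P : ℝ[X]} (h0 : P.coeff 0 = 1)
    (h1 : P.coeff 1 = 0) :
    ∃ C : ℝ, ∀ x ∈ Set.Icc (0 : ℝ) 1, |P.eval x - 1| ≤ C * x ^ 2 := by
  obtain ⟨g, hg⟩ : (X : ℝ[X]) ^ 2 ∣ P - 1 := by
    refine X_pow_dvd_iff.2 fun d hd => ?_
    interval_cases d
    · simp [h0]
    · simp [h1, coeff_one]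
  obtain ⟨C, hC⟩ := isCompact_Icc.exists_bound_of_continuousOn (s := Set.Icc (0 : ℝ) 1)
    g.continuous.continuousOn
  refine ⟨C, fun x hx => ?_⟩
  have hx' : P.eval x - 1 = x ^ 2 * g.eval x := by
    simpa using congrArg (eval x) hg
  rw [hx', abs_mul, abs_of_nonneg (sq_nonneg x), mul_comm]
  exact mul_le_mul_of_nonneg_right (hC x hx) (sq_nonneg x)

open Polynomial in
/-- An Euler product whose local factors are `P(1/p)` for a polynomial `P = 1 + O(X²)`, with all
local factors positive, converges to a positive number. -/
lemma Polynomial.multipliable_eval_inv_primes_and_tprod_pos {P : ℝ[X]} (h0 : P.coeff 0 = 1)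
    (h1 : P.coeff 1 = 0) (hpos : ∀ p : Nat.Primes, 0 < P.eval ((p : ℝ)⁻¹)) :
    Multipliable (fun p : Nat.Primes => P.eval ((p : ℝ)⁻¹)) ∧
      0 < ∏' p : Nat.Primes, P.eval ((p : ℝ)⁻¹) := by
  obtain ⟨C, hC⟩ := exists_abs_eval_sub_one_le_mul_sq h0 h1
  have hsq : Summable fun p : Nat.Primes => C * ((p : ℝ)⁻¹) ^ 2 := by
    refine Summable.mul_left C ?_
    have h : Summable fun k : ℕ => ((k : ℝ) ^ 2)⁻¹ :=
      Real.summable_nat_pow_inv.2 one_lt_two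
    simp only [inv_pow]
    exact h.comp_injective Nat.Primes.coe_nat_injective
  have hsum : Summable fun p : Nat.Primes => P.eval ((p : ℝ)⁻¹) - 1 := by
    refine hsq.of_norm_bounded fun p => hC _ ⟨by positivity, ?_⟩
    exact inv_le_one_of_one_le₀ (by exact_mod_cast p.2.one_lt.le)
  have hlog : Summable fun p : Nat.Primes => Real.log (P.eval ((p : ℝ)⁻¹)) := by
    simpa using Real.summable_log_one_add_of_summable hsum
  refine ⟨Real.multipliable_of_summable_log hpos hlog, ?_⟩
  rw [← Real.rexp_tsum_eq_tprod hpos hlog]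
  exact Real.exp_pos _

open Polynomial in
lemma Polynomial.coeff_one_one_sub_X_pow (N : ℕ) :
    ((1 - X : ℝ[X]) ^ N).coeff 1 = -N := by
  induction N with
  | zero => simp [coeff_one]
  | succ N ih => rw [pow_succ, mul_coeff_one, ih]; simp [coeff_zero_eq_eval_zero, coeff_one]


/-- For `n ≥ 1`, the family, indexed by the primes `p`, of positive real numbers
`(1 - 1/p)^{(n-1)²} ∑_{m=0}^{n-1} C(n-1,m)² p^{-m}` is multipliable, and the value
`α_n` of its product over all primes is strictly positive. -/
theorem arithmetic_factor_multipliable_and_positive (n : ℕ) (hn : 1 ≤ n) :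
    Multipliable (fun p : Nat.Primes =>
      (1 - 1 / ((p : ℕ) : ℝ)) ^ ((n - 1) ^ 2)
        * ∑ m ∈ Finset.range n, (Nat.choose (n - 1) m : ℝ) ^ 2 * (((p : ℕ) : ℝ) ^ m)⁻¹)
    ∧ 0 < ∏' p : Nat.Primes,
        (1 - 1 / ((p : ℕ) : ℝ)) ^ ((n - 1) ^ 2)
          * ∑ m ∈ Finset.range n, (Nat.choose (n - 1) m : ℝ) ^ 2 * (((p : ℕ) : ℝ) ^ m)⁻¹ := by
  obtain ⟨k, rfl⟩ : ∃ k, n = k + 1 := ⟨n - 1, by omega⟩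
  simp only [Nat.add_sub_cancel]
  let S : Polynomial ℝ := ∑ m ∈ Finset.range (k + 1),
    Polynomial.C ((Nat.choose k m : ℝ) ^ 2) * Polynomial.X ^ m
  let P : Polynomial ℝ := (1 - Polynomial.X) ^ (k ^ 2) * S
  have hS0 : S.coeff 0 = 1 := by
    simp [S, Polynomial.coeff_X_pow]
  have hS1 : S.coeff 1 = (k : ℝ) ^ 2 := by
    simp only [S, Polynomial.finsetSum_coeff, Polynomial.coeff_C_mul_X_pow]
    rw [Finset.sum_ite_eq]
    rcases Nat.eq_zero_or_pos k with rfl | hk <;> simp [*]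
  have hP0 : P.coeff 0 = 1 := by
    rw [Polynomial.mul_coeff_zero, hS0]
    simp [Polynomial.coeff_zero_eq_eval_zero]
  have hP1 : P.coeff 1 = 0 := by
    rw [Polynomial.mul_coeff_one, hS0, hS1, Polynomial.coeff_one_one_sub_X_pow]
    simp [Polynomial.coeff_zero_eq_eval_zero]
  have heval (p : Nat.Primes) : (1 - 1 / ((p : ℕ) : ℝ)) ^ (k ^ 2) *
      ∑ m ∈ Finset.range (k + 1), (Nat.choose k m : ℝ) ^ 2 * (((p : ℕ) : ℝ) ^ m)⁻¹ =
      P.eval ((p : ℝ)⁻¹) := by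
    simp [P, S, Polynomial.eval_finsetSum]
  simp only [heval]
  refine Polynomial.multipliable_eval_inv_primes_and_tprod_pos hP0 hP1 fun p => ?_
  rw [← heval]
  have hp : (1 : ℝ) < p := by exact_mod_cast p.2.one_lt
  refine mul_pos (pow_pos ?_ _) (Finset.sum_pos (fun m hm => ?_) (by simp))
  · rw [one_div]
    exact sub_pos.2 (inv_lt_one_of_one_lt₀ hp)
  · have := Nat.choose_pos (Nat.lt_succ_iff.1 (Finset.mem_range.1 hm))
    positivity
end
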